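/- For every real number d ≠ 0 and every real z > 2, one has z/d + ∫_ℝ (t − z)^{−1} dσ(t) = ((2 − d)·z + d·√(z² − 4)) / (2d); in particular (taking d = 2), ∫_ℝ (t − z)^{−1} dσ(t) = (−z + √(z² − 4))/2. -/

import Mathlib

open MeasureTheory

/-- The semicircle distribution: the probability measure on `ℝ` with density
`t ↦ (1/(2π))√(4−t²)` on `[−2,2]` and `0` elsewhere (recall `Real.sqrt` of a negative
number is `0`). -/
noncomputable def semicircle : Measure ℝ :=
  MeasureTheory.volume.withDensity fun t => ENNReal.ofReal ((2 * Real.pi)⁻¹ * Real.sqrt (4 - t ^ 2))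

/-- An antiderivative of `t ↦ √(4 - t ^ 2) / (t - z)` on `(-2, 2)`. -/
theorem hasDerivAt_semicircle_primitive {z t : ℝ} (hz : 2 < z) (ht : t ∈ Set.Ioo (-2 : ℝ) 2) :
    HasDerivAt (fun t => Real.sqrt (4 - t ^ 2) - z * Real.arcsin (t / 2) +
      Real.sqrt (z ^ 2 - 4) * Real.arcsin ((z * t - 4) / (2 * (z - t))))
      (Real.sqrt (4 - t ^ 2) * (t - z)⁻¹) t := by
  obtain ⟨h1, h2⟩ := ht
  have hr : 0 < 4 - t ^ 2 := by nlinarith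
  have hs : 0 < z ^ 2 - 4 := by nlinarith
  have hzt : 0 < z - t := by linarith
  have hr' := Real.sqrt_pos.2 hr
  have hs' := Real.sqrt_pos.2 hs
  have hr2 := Real.sq_sqrt hr.le
  have hs2 := Real.sq_sqrt hs.le
  have e1 : Real.sqrt (1 - (t / 2) ^ 2) = Real.sqrt (4 - t ^ 2) / 2 := by
    rw [Real.sqrt_eq_iff_mul_self_eq (by nlinarith) (by positivity)]
    linear_combination -hr2 / 4
  have hu : 1 - ((z * t - 4) / (2 * (z - t))) ^ 2 =
      (Real.sqrt (z ^ 2 - 4) * Real.sqrt (4 - t ^ 2) / (2 * (z - t))) ^ 2 := by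
    rw [div_pow, div_pow _ (2 * (z - t)), mul_pow (Real.sqrt _), hr2, hs2]
    field_simp
    ring
  have e2 : Real.sqrt (1 - ((z * t - 4) / (2 * (z - t))) ^ 2) =
      Real.sqrt (z ^ 2 - 4) * Real.sqrt (4 - t ^ 2) / (2 * (z - t)) := by
    rw [hu, Real.sqrt_sq (by positivity)]
  have hu1 : ((z * t - 4) / (2 * (z - t))) ^ 2 < 1 := by
    have : 0 < (Real.sqrt (z ^ 2 - 4) * Real.sqrt (4 - t ^ 2) / (2 * (z - t))) ^ 2 := by positivity
    linarith
  obtain ⟨hu2, hu3⟩ := (sq_lt_one_iff_abs_lt_one _).1 hu1 |> abs_lt.1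
  have d1 : HasDerivAt (fun t : ℝ => Real.sqrt (4 - t ^ 2))
      (-(2 * t) / (2 * Real.sqrt (4 - t ^ 2))) t := by
    have := ((hasDerivAt_pow 2 t).const_sub 4).sqrt hr.ne'
    simpa using this
  have d2 : HasDerivAt (fun t : ℝ => Real.arcsin (t / 2))
      (1 / Real.sqrt (1 - (t / 2) ^ 2) * (1 / 2)) t :=
    (Real.hasDerivAt_arcsin (by linarith) (by linarith)).comp t ((hasDerivAt_id t).div_const 2)
  have d3 : HasDerivAt (fun t : ℝ => (z * t - 4) / (2 * (z - t)))
      ((z * 1 * (2 * (z - t)) - (z * t - 4) * (2 * (-1))) / (2 * (z - t)) ^ 2) t :=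
    (((hasDerivAt_id t).const_mul z).sub_const 4).div
      (((hasDerivAt_id t).const_sub z).const_mul 2) (by positivity)
  have d4 := (Real.hasDerivAt_arcsin hu2.ne' hu3.ne).comp t d3
  refine ((d1.sub (d2.const_mul z)).add (d4.const_mul (Real.sqrt (z ^ 2 - 4)))).congr_deriv ?_
  rw [e1, e2, show (t - z)⁻¹ = -(z - t)⁻¹ by rw [← inv_neg, neg_sub]]
  field_simp
  rw [hr2]
  ring

theorem integral_sqrt_mul_inv_sub {z : ℝ} (hz : 2 < z) :
    ∫ t in (-2 : ℝ)..2, Real.sqrt (4 - t ^ 2) * (t - z)⁻¹ =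
      Real.pi * (-z + Real.sqrt (z ^ 2 - 4)) := by
  have hc : ∀ t ∈ Set.Icc (-2 : ℝ) 2, t - z ≠ 0 := fun t ht => by linarith [ht.2]
  have hc' : ∀ t ∈ Set.Icc (-2 : ℝ) 2, 2 * (z - t) ≠ 0 := fun t ht => by
    have := ht.2
    linarith
  rw [intervalIntegral.integral_eq_sub_of_hasDerivAt_of_le (by norm_num) ?_
    (fun t ht => hasDerivAt_semicircle_primitive hz ht) ?_]
  · have h1 : (z * 2 - 4) / (2 * (z - 2)) = 1 := by
      rw [div_eq_one_iff_eq (by linarith)]; ring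
    have h2 : (z * (-2) - 4) / (2 * (z - (-2))) = -1 := by
      rw [div_eq_iff (by linarith)]; ring
    rw [h1, h2]
    norm_num
    ring
  · refine ContinuousOn.add (by fun_prop) (continuousOn_const.mul ?_)
    exact Real.continuous_arcsin.comp_continuousOn
      (ContinuousOn.div (by fun_prop) (by fun_prop) hc')
  · apply ContinuousOn.intervalIntegrable
    rw [Set.uIcc_of_le (by norm_num)]
    exact ContinuousOn.mul (by fun_prop) (ContinuousOn.inv₀ (by fun_prop) hc)

theorem integral_semicircle (f : ℝ → ℝ) :
    ∫ t, f t ∂semicircle =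
      (2 * Real.pi)⁻¹ * ∫ t in (-2 : ℝ)..2, Real.sqrt (4 - t ^ 2) * f t := by
  rw [semicircle, integral_withDensity_eq_integral_toReal_smul (by fun_prop) (by simp),
    intervalIntegral.integral_of_le (by norm_num), ← integral_const_mul,
    setIntegral_eq_integral_of_forall_compl_eq_zero]
  · refine integral_congr_ae (.of_forall fun t => ?_)
    dsimp only
    rw [ENNReal.toReal_ofReal (by positivity), smul_eq_mul, mul_assoc]
  · intro t ht
    have : 4 - t ^ 2 ≤ 0 := by
      by_contra! h
      exact ht ⟨by nlinarith, by nlinarith⟩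
    simp [Real.sqrt_eq_zero_of_nonpos this]

/-- For `d ≠ 0` and real `z > 2`, the value of the limiting Weyl function:
`z/d + ∫ (t − z)⁻¹ dσ(t) = ((2 − d)z + d√(z² − 4))/(2d)`; in particular (the case `d = 2`)
the Stieltjes transform of the semicircle law is `∫ (t − z)⁻¹ dσ(t) = (−z + √(z² − 4))/2`. -/
theorem stmt_17 (d : ℝ) (hd : d ≠ 0) (z : ℝ) (hz : 2 < z) :
    z / d + (∫ t, (t - z)⁻¹ ∂semicircle) =
      ((2 - d) * z + d * Real.sqrt (z ^ 2 - 4)) / (2 * d) ∧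
    (∫ t, (t - z)⁻¹ ∂semicircle) = (-z + Real.sqrt (z ^ 2 - 4)) / 2 := by
  have h : (∫ t, (t - z)⁻¹ ∂semicircle) = (-z + Real.sqrt (z ^ 2 - 4)) / 2 := by
    rw [integral_semicircle, integral_sqrt_mul_inv_sub hz]
    field_simp
  refine ⟨?_, h⟩
  rw [h]
  field_simp
  ring
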